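/- Let Ω ⊂ ℝ^d be compact and convex with non-empty interior, V a real finite-dimensional inner product space, and μ, ν ∈ M(Ω;V) with the same total mass. Then the dual value sup{ ∫_Ω ⟨φ, ν−μ⟩_V : φ ∈ C(Ω;V), |∇φ|_{V^d,∞} ≤ 1 } equals the Beckmann value inf{ ∫_Ω |σ|_{V^d} : σ ∈ M(Ω;V^d), div(σ) = μ−ν }, where the divergence constraint holds in the weak sense with zero-flux boundary conditions. -/

import Mathlib

open MeasureTheory Set Filter
open scoped ENNReal RealInnerProductSpace Topology

noncomputable section

/-- Euclidean space `ℝ^d`. -/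
abbrev Euc (d : ℕ) := EuclideanSpace ℝ (Fin d)

variable {d : ℕ} {V : Type*} [NormedAddCommGroup V] [InnerProductSpace ℝ V]
  [FiniteDimensional ℝ V]

/-- Frobenius inner product on `V^d ≅ L(ℝ^d; V)`: `⟨A,B⟩ = Tr(Aᵀ B)`. -/
def frobInner (A B : Euc d →L[ℝ] V) : ℝ :=
  ∑ i, ⟪A (EuclideanSpace.single i 1), B (EuclideanSpace.single i 1)⟫

/-- Frobenius norm on `V^d ≅ L(ℝ^d; V)`. -/
def frobNorm (A : Euc d →L[ℝ] V) : ℝ :=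
  Real.sqrt (∑ i, ‖A (EuclideanSpace.single i 1)‖ ^ 2)

/-- Componentwise divergence of a (smooth) map `ψ : ℝ^d → V^d`. -/
def divg (ψ : Euc d → Euc d →L[ℝ] V) (x : Euc d) : V :=
  ∑ i, fderiv ℝ ψ x (EuclideanSpace.single i 1) (EuclideanSpace.single i 1)

/-- Test functions: smooth, compactly supported in the interior of `Ω`. -/
def IsTest (Ω : Set (Euc d)) (ψ : Euc d → Euc d →L[ℝ] V) : Prop :=
  ContDiff ℝ (⊤ : ℕ∞) ψ ∧ HasCompactSupport ψ ∧ tsupport ψ ⊆ interior Ω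

/-- `g` is the (componentwise) distributional gradient of `φ` on `Ω`:
for every test function `ψ`, `∫_Ω ⟨φ, div ψ⟩ = -∫_Ω ⟨g, ψ⟩_{V^d}`. -/
def IsDistribGrad (Ω : Set (Euc d)) (φ : Euc d → V)
    (g : Euc d → Euc d →L[ℝ] V) : Prop :=
  ∀ ψ : Euc d → Euc d →L[ℝ] V, IsTest Ω ψ →
    ∫ x in Ω, ⟪φ x, divg ψ x⟫ = - ∫ x in Ω, frobInner (g x) (ψ x)

/-- `φ ∈ C(Ω;V)` and its distributional gradient admits an `L^∞` representative
whose Frobenius norm is at most `c` almost everywhere on `Ω`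
(i.e. `|∇φ|_{V^d,∞} ≤ c`). -/
def FrLipOn (c : ℝ) (Ω : Set (Euc d)) (φ : Euc d → V) : Prop :=
  ContinuousOn φ Ω ∧ ∃ g : Euc d → Euc d →L[ℝ] V,
    AEStronglyMeasurable g (volume.restrict Ω) ∧
    (∀ᵐ x ∂(volume.restrict Ω), frobNorm (g x) ≤ c) ∧
    IsDistribGrad Ω φ g

/-- A finite `W`-valued measure on `Ω`, represented (by polar decomposition /
Radon–Nikodym) as a density `den` integrable against a positive measure `ρ`
concentrated on `Ω`. -/
structure VMeas (Ω : Set (Euc d)) (W : Type*) [NormedAddCommGroup W] where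
  ρ : Measure (Euc d)
  den : Euc d → W
  null_compl : ρ Ωᶜ = 0
  integrable : Integrable den ρ

namespace VMeas

variable {Ω : Set (Euc d)}

/-- Duality pairing `∫_Ω ⟨φ, μ⟩_V` of `μ ∈ M(Ω;V)` with `φ : Ω → V`. -/
def pair (μ : VMeas Ω V) (φ : Euc d → V) : ℝ :=
  ∫ x, ⟪φ x, μ.den x⟫ ∂μ.ρ

/-- Total variation norm `∫_Ω |μ|_V` of `μ ∈ M(Ω;V)`. -/
def tv (μ : VMeas Ω V) : ℝ := ∫ x, ‖μ.den x‖ ∂μ.ρ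

/-- Total mass `∫_Ω μ ∈ V` of `μ ∈ M(Ω;V)`. -/
def mass (μ : VMeas Ω V) : V := ∫ x, μ.den x ∂μ.ρ

/-- Frobenius duality pairing `∫_Ω ⟨ψ, σ⟩_{V^d}` of `σ ∈ M(Ω;V^d)` with
`ψ : Ω → V^d`. -/
def fpair (σ : VMeas Ω (Euc d →L[ℝ] V)) (ψ : Euc d → Euc d →L[ℝ] V) : ℝ :=
  ∫ x, frobInner (ψ x) (σ.den x) ∂σ.ρ

/-- Total variation norm `∫_Ω |σ|_{V^d}` of `σ ∈ M(Ω;V^d)` w.r.t. the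
Frobenius norm on `V^d`. -/
def ftv (σ : VMeas Ω (Euc d →L[ℝ] V)) : ℝ := ∫ x, frobNorm (σ.den x) ∂σ.ρ

end VMeas

/-- The divergence constraint `div σ = D` (with zero-flux boundary conditions),
in the weak sense: `-∫_Ω ⟨∇φ, σ⟩_{V^d} = D(φ)` for every `φ ∈ C¹(Ω;V)`.
Here `D` is the pairing functional of the prescribed right-hand side. -/
def DivEq {Ω : Set (Euc d)} (σ : VMeas Ω (Euc d →L[ℝ] V))
    (D : (Euc d → V) → ℝ) : Prop :=
  ∀ φ : Euc d → V, ContDiff ℝ 1 φ → -(σ.fpair fun x => fderiv ℝ φ x) = D φ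

/-- The (possibly infinite) value `sup { D(φ) : |∇φ|_{V^d,∞} ≤ 1 }`, used to
define `W₁^V` through the pairing functional `D` of `ν - μ`. -/
def W1fn (Ω : Set (Euc d)) (D : (Euc d → V) → ℝ) : ℝ≥0∞ :=
  ⨆ φ ∈ {φ : Euc d → V | FrLipOn 1 Ω φ}, ENNReal.ofReal (D φ)

open scoped CompactlySupported
set_option linter.unusedSectionVars false

theorem HB_ext {E G : Type*} [AddCommGroup E] [Module ℝ E] [AddCommGroup G] [Module ℝ G]
    (T : E →ₗ[ℝ] G) (L : E →ₗ[ℝ] ℝ) (N : G → ℝ)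
    (N_hom : ∀ c : ℝ, 0 < c → ∀ x, N (c • x) = c * N x) (N_add : ∀ x y, N (x + y) ≤ N x + N y)
    (h : ∀ e, L e ≤ N (T e)) :
    ∃ g : G →ₗ[ℝ] ℝ, (∀ e, g (T e) = L e) ∧ ∀ x, g x ≤ N x := by
  have N_0 : N 0 = 0 := by grind [N_hom 2 (by norm_num) 0, smul_zero]
  have hker : LinearMap.ker T ≤ LinearMap.ker L := by
    intro e he
    rw [LinearMap.mem_ker] at he ⊢
    have h1 := h e
    have h2 := h (-e)
    rw [map_neg, map_neg, he, neg_zero, N_0] at h2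
    rw [he, N_0] at h1
    linarith
  let q : LinearMap.range T →ₗ[ℝ] ℝ :=
    ((LinearMap.ker T).liftQ L hker).comp T.quotKerEquivRange.symm.toLinearMap
  have hq : ∀ e, q ⟨T e, LinearMap.mem_range_self T e⟩ = L e := by
    intro e
    have : T.quotKerEquivRange.symm ⟨T e, LinearMap.mem_range_self T e⟩
        = (LinearMap.ker T).mkQ e := by
      rw [LinearEquiv.symm_apply_eq]
      rfl
    simp only [q, LinearMap.comp_apply, LinearEquiv.coe_coe, this]
    simp
  obtain ⟨g, hg1, hg2⟩ := exists_extension_of_le_sublinear ⟨LinearMap.range T, q⟩ N N_hom N_add (by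
    rintro ⟨_, e, rfl⟩
    exact (hq e).le.trans (h e))
  exact ⟨g, fun e => (hg1 ⟨T e, LinearMap.mem_range_self T e⟩).trans (hq e), hg2⟩

theorem vecRiesz_pos {X W E : Type*} [TopologicalSpace X] [CompactSpace X] [T2Space X]
    [MeasurableSpace X] [BorelSpace X] [Nonempty X]
    [NormedAddCommGroup W] [NormedSpace ℝ W]
    [AddCommGroup E] [Module ℝ E]
    (T : E →ₗ[ℝ] C(X, W)) (L : E →ₗ[ℝ] ℝ) (S : ℝ) (hS : 0 ≤ S)
    (h : ∀ e, L e ≤ S * ⨆ x, ‖T e x‖) :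
    ∃ ρ : Measure X, IsFiniteMeasure ρ ∧ ρ.real univ ≤ S ∧
      ∀ e, L e ≤ ∫ x, ‖T e x‖ ∂ρ := by
  let N : C(X, ℝ) × C(X, W) → ℝ := fun p => S * ⨆ x, (p.1 x + ‖p.2 x‖)
  have hbdd : ∀ p : C(X, ℝ) × C(X, W), BddAbove (range fun x => p.1 x + ‖p.2 x‖) := by
    intro p
    exact (isCompact_range (by fun_prop)).bddAbove
  obtain ⟨g, hg1, hg2⟩ := HB_ext (LinearMap.prod (0 : E →ₗ[ℝ] C(X, ℝ)) T) L N (by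
      intro c hc p
      have : ∀ x, (c • p).1 x + ‖(c • p).2 x‖ = c * (p.1 x + ‖p.2 x‖) := by
        intro x
        simp [norm_smul, abs_of_pos hc]
        ring
      simp only [N, this]
      rw [← Real.mul_iSup_of_nonneg hc.le]
      ring) (by
      intro p q
      simp only [N]
      rw [← mul_add]
      refine mul_le_mul_of_nonneg_left (ciSup_le fun x => ?_) hS
      have h1 := le_ciSup (hbdd p) x
      have h2 := le_ciSup (hbdd q) x
      have h3 := norm_add_le (p.2 x) (q.2 x)
      simp only [Prod.fst_add, Prod.snd_add, ContinuousMap.add_apply] at h1 h2 ⊢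
      linarith) (by
      intro e
      simpa [N] using h e)
  have hpos : ∀ f : C(X, ℝ), (∀ x, 0 ≤ f x) → 0 ≤ g (f, 0) := by
    intro f hf
    have h1 : g (-f, 0) ≤ 0 := by
      refine (hg2 _).trans ?_
      refine mul_nonpos_of_nonneg_of_nonpos hS (ciSup_le fun x => ?_)
      simpa using hf x
    have h2 : g (-f, 0) = - g (f, 0) := by
      rw [← map_neg]; simp
    linarith
  let Λ : C_c(X, ℝ) →ₚ[ℝ] ℝ :=
  { toFun f := g (f.toContinuousMap, 0)
    map_add' f f' := by
      rw [← map_add]; simp; rfl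
    map_smul' c f := by
      rw [RingHom.id_apply, ← map_smul]; simp; rfl
    monotone' f f' hff' := by
      have h0 := hpos (f'.toContinuousMap - f.toContinuousMap) (fun x => by
        simpa using hff' x)
      have h1 : ((f'.toContinuousMap - f.toContinuousMap, 0) : C(X, ℝ) × C(X, W)) =
        (f'.toContinuousMap, 0) - (f.toContinuousMap, 0) := by simp
      rw [h1, map_sub] at h0
      exact sub_nonneg.mp h0 }
  have hint : ∀ f : C(X, ℝ), ∫ x, f x ∂(RealRMK.rieszMeasure Λ) = g (f, 0) := by
    intro f
    exact RealRMK.integral_rieszMeasure Λ ⟨f, HasCompactSupport.of_compactSpace _⟩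
  refine ⟨RealRMK.rieszMeasure Λ, inferInstance, ?_, ?_⟩
  · have h1 := hint 1
    simp only [ContinuousMap.one_apply, integral_const, smul_eq_mul, mul_one] at h1
    rw [h1]
    refine (hg2 _).trans ?_
    simp [N]
  · intro e
    have h1 := hint ⟨fun x => ‖T e x‖, by fun_prop⟩
    simp only [ContinuousMap.coe_mk] at h1
    rw [h1, ← hg1 e]
    have h2 := hg2 (-⟨fun x => ‖T e x‖, by fun_prop⟩, T e)
    have h3 : ((-⟨fun x => ‖T e x‖, by fun_prop⟩, T e) : C(X, ℝ) × C(X, W)) =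
      (0, T e) - (⟨fun x => ‖T e x‖, by fun_prop⟩, 0) := by simp
    rw [h3, map_sub, ← h3] at h2
    have h4 : N (-⟨fun x => ‖T e x‖, by fun_prop⟩, T e) = 0 := by simp [N]
    rw [h4] at h2
    simpa using h2

theorem vecRiesz {X W E : Type*} [TopologicalSpace X] [CompactSpace X] [T2Space X]
    [MeasurableSpace X] [BorelSpace X] [Nonempty X] [SecondCountableTopology X]
    [NormedAddCommGroup W] [InnerProductSpace ℝ W] [CompleteSpace W]
    [AddCommGroup E] [Module ℝ E]
    (T : E →ₗ[ℝ] C(X, W)) (L : E →ₗ[ℝ] ℝ) (S : ℝ) (hS : 0 ≤ S)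
    (h : ∀ e, L e ≤ S * ⨆ x, ‖T e x‖) :
    ∃ (ρ : Measure X) (k : X → W), Integrable k ρ ∧
      (∀ e, ∫ x, ⟪T e x, k x⟫ ∂ρ = L e) ∧ ∫ x, ‖k x‖ ∂ρ ≤ S := by
  obtain ⟨ρ, hfin, hρS, hL⟩ := vecRiesz_pos T L S hS h
  have hint : ∀ f : Lp W 2 ρ, Integrable f ρ := fun f =>
    (Lp.memLp f).integrable (by norm_num)
  let TL : C(X, W) →L[ℝ] Lp W 2 ρ := ContinuousMap.toLp 2 ρ ℝ
  obtain ⟨g, hg1, hg2⟩ := HB_ext (TL.toLinearMap.comp T) L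
    (fun f : Lp W 2 ρ => ∫ x, ‖f x‖ ∂ρ) (by
      intro c hc f
      rw [← integral_const_mul]
      refine integral_congr_ae ?_
      filter_upwards [Lp.coeFn_smul c f] with x hx
      rw [hx]; simp [norm_smul, abs_of_pos hc]) (by
      intro f f'
      rw [← integral_add (hint f).norm (hint f').norm]
      refine integral_mono_ae (hint _).norm ((hint f).norm.add (hint f').norm) ?_
      filter_upwards [Lp.coeFn_add f f'] with x hx
      rw [hx]; exact norm_add_le _ _) (by
      intro e
      refine (hL e).trans (le_of_eq (integral_congr_ae ?_))
      filter_upwards [ContinuousMap.coeFn_toLp (p := 2) (𝕜 := ℝ) ρ (T e)] with x hx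
      simp only [TL, LinearMap.comp_apply, ContinuousLinearMap.coe_coe, hx])
  have hbound : ∀ f : Lp W 2 ρ, ∫ x, ‖f x‖ ∂ρ ≤ (ρ.real univ) ^ (1/2 : ℝ) * ‖f‖ := by
    intro f
    have h1 := eLpNorm_le_eLpNorm_mul_rpow_measure_univ (p := 1) (q := 2) (μ := ρ) (by norm_num)
      (Lp.memLp f).1
    have h2 : ∫ x, ‖f x‖ ∂ρ = (eLpNorm f 1 ρ).toReal := by
      rw [eLpNorm_one_eq_lintegral_enorm, integral_norm_eq_lintegral_enorm (Lp.memLp f).1]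
    rw [h2, Lp.norm_def, measureReal_def, ENNReal.toReal_rpow, ← ENNReal.toReal_mul, mul_comm]
    refine ENNReal.toReal_mono (ENNReal.mul_ne_top (Lp.eLpNorm_ne_top f)
      (ENNReal.rpow_ne_top_of_nonneg (by norm_num) (measure_ne_top _ _))) ?_
    convert h1 using 3
    norm_num
  let gc : StrongDual ℝ (Lp W 2 ρ) := g.mkContinuous ((ρ.real univ) ^ (1/2 : ℝ)) (by
    intro f
    rw [Real.norm_eq_abs, abs_le]
    constructor
    · have := (hg2 (-f)).trans (hbound (-f))
      rw [map_neg, norm_neg] at this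
      linarith
    · exact (hg2 f).trans (hbound f))
  let k : Lp W 2 ρ := (InnerProductSpace.toDual ℝ _).symm gc
  have hk : ∀ f, g f = ∫ x, ⟪k x, f x⟫ ∂ρ := by
    intro f
    rw [← L2.inner_def]
    simp only [k, InnerProductSpace.toDual_symm_apply]
    rfl
  refine ⟨ρ, k, hint k, ?_, ?_⟩
  · intro e
    rw [← hg1 e, hk]
    refine integral_congr_ae ?_
    filter_upwards [ContinuousMap.coeFn_toLp (p := 2) (𝕜 := ℝ) ρ (T e)] with x hx
    simp only [TL, LinearMap.comp_apply, ContinuousLinearMap.coe_coe, hx]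
    exact real_inner_comm _ _
  · let u : X → W := fun x => ‖k x‖⁻¹ • k x
    have hu1 : ∀ x, ‖u x‖ ≤ 1 := by
      intro x
      simp only [u, norm_smul, norm_inv, norm_norm]
      exact inv_mul_le_one
    have hum : AEStronglyMeasurable u ρ :=
      ((Lp.aestronglyMeasurable k).norm.aemeasurable.inv.aestronglyMeasurable).smul
        (Lp.aestronglyMeasurable k)
    have huL : MemLp u 2 ρ := MemLp.of_bound hum 1 (ae_of_all _ hu1)
    have h1 := hg2 (huL.toLp u)
    rw [hk] at h1
    have h2 : ∫ x, ⟪k x, huL.toLp u x⟫ ∂ρ = ∫ x, ‖k x‖ ∂ρ := by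
      refine integral_congr_ae ?_
      filter_upwards [huL.coeFn_toLp] with x hx
      rw [hx]
      simp only [u, inner_smul_right, real_inner_self_eq_norm_sq]
      by_cases h0 : ‖k x‖ = 0
      · simp [h0]
      · field_simp
    rw [h2] at h1
    refine h1.trans (le_trans ?_ hρS)
    have h3 : ∫ x, ‖huL.toLp u x‖ ∂ρ ≤ ∫ x, (1 : ℝ) ∂ρ := by
      refine integral_mono_ae (hint _).norm (integrable_const _) ?_
      filter_upwards [huL.coeFn_toLp] with x hx
      rw [hx]; exact hu1 x
    simpa using h3


abbrev WW (d : ℕ) (V : Type*) [NormedAddCommGroup V] [InnerProductSpace ℝ V] :=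
  PiLp 2 (fun _ : Fin d => V)

def toWl : (Euc d →L[ℝ] V) →ₗ[ℝ] WW d V where
  toFun A := WithLp.toLp 2 (fun i => A (EuclideanSpace.single i 1))
  map_add' A B := by ext i; simp
  map_smul' c A := by ext i; simp

def toW : (Euc d →L[ℝ] V) →L[ℝ] WW d V := LinearMap.toContinuousLinearMap toWl

theorem toW_apply (A : Euc d →L[ℝ] V) (i : Fin d) :
    toW A i = A (EuclideanSpace.single i 1) := rfl

def fromWl : WW d V →ₗ[ℝ] (Euc d →L[ℝ] V) where
  toFun w := ∑ i, (EuclideanSpace.proj (𝕜 := ℝ) i).smulRight (w i)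
  map_add' w w' := by ext x; simp [Finset.sum_add_distrib]
  map_smul' c w := by
    ext x
    simp only [PiLp.smul_apply, RingHom.id_apply, smul_apply,
      sum_apply, ContinuousLinearMap.smulRight_apply, Finset.smul_sum]
    exact Finset.sum_congr rfl fun i _ => smul_comm _ _ _

def fromW : WW d V →L[ℝ] (Euc d →L[ℝ] V) := LinearMap.toContinuousLinearMap fromWl

theorem toW_fromW (w : WW d V) : toW (fromW w) = w := by
  ext i
  rw [toW_apply]
  simp only [fromW, fromWl, LinearMap.coe_toContinuousLinearMap', LinearMap.coe_mk, AddHom.coe_mk,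
    sum_apply, ContinuousLinearMap.smulRight_apply]
  rw [Finset.sum_eq_single i]
  · simp
  · intro j _ hj
    simp [hj]
  · simp

theorem frobInner_eq (A B : Euc d →L[ℝ] V) : frobInner A B = ⟪toW A, toW B⟫ := by
  rw [PiLp.inner_apply]; rfl

theorem frobNorm_eq (A : Euc d →L[ℝ] V) : frobNorm A = ‖toW A‖ := by
  rw [PiLp.norm_eq_of_L2]; rfl

theorem frobNorm_smul (c : ℝ) (A : Euc d →L[ℝ] V) : frobNorm (c • A) = |c| * frobNorm A := by
  rw [frobNorm_eq, frobNorm_eq, map_smul, norm_smul, Real.norm_eq_abs]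

theorem abs_frobInner_le (A B : Euc d →L[ℝ] V) : |frobInner A B| ≤ frobNorm A * frobNorm B := by
  rw [frobNorm_eq, frobNorm_eq, frobInner_eq]; exact abs_real_inner_le_norm _ _

theorem frobInner_self (A : Euc d →L[ℝ] V) : frobInner A A = frobNorm A ^ 2 := by
  rw [frobNorm_eq, frobInner_eq, real_inner_self_eq_norm_sq]

theorem VMeas.ae_mem {Ω : Set (Euc d)} {W : Type*} [NormedAddCommGroup W] (μ : VMeas Ω W) :
    ∀ᵐ x ∂μ.ρ, x ∈ Ω := μ.null_compl

theorem VMeas.aesm {Ω : Set (Euc d)} (hΩ : IsCompact Ω) {W U : Type*} [NormedAddCommGroup W]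
    [NormedAddCommGroup U]
    (μ : VMeas Ω W) {φ : Euc d → U} (hφ : ContinuousOn φ Ω) : AEStronglyMeasurable φ μ.ρ := by
  have h := hφ.aestronglyMeasurable (μ := μ.ρ) hΩ.measurableSet
  rwa [Measure.restrict_eq_self_of_ae_mem μ.ae_mem] at h

theorem VMeas.pair_integrable {Ω : Set (Euc d)} (hΩ : IsCompact Ω) (μ : VMeas Ω V) {φ : Euc d → V}
    (hφ : ContinuousOn φ Ω) : Integrable (fun x => ⟪φ x, μ.den x⟫) μ.ρ := by
  obtain ⟨C, hC⟩ := hΩ.exists_bound_of_continuousOn hφ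
  refine Integrable.mono' (μ.integrable.norm.const_mul C)
    ((μ.aesm hΩ hφ).inner μ.integrable.1) ?_
  filter_upwards [μ.ae_mem] with x hx
  exact (norm_inner_le_norm _ _).trans (mul_le_mul_of_nonneg_right (hC x hx) (norm_nonneg _))

theorem VMeas.pair_add {Ω : Set (Euc d)} (hΩ : IsCompact Ω) (μ : VMeas Ω V) {φ φ' : Euc d → V}
    (hφ : ContinuousOn φ Ω) (hφ' : ContinuousOn φ' Ω) :
    μ.pair (φ + φ') = μ.pair φ + μ.pair φ' := by
  unfold VMeas.pair
  rw [← integral_add (μ.pair_integrable hΩ hφ) (μ.pair_integrable hΩ hφ')]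
  simp [inner_add_left]

theorem VMeas.pair_smul {Ω : Set (Euc d)} (μ : VMeas Ω V) (c : ℝ) (φ : Euc d → V) :
    μ.pair (c • φ) = c * μ.pair φ := by
  unfold VMeas.pair
  rw [← integral_const_mul]
  simp [inner_smul_left]

theorem VMeas.pair_sub_le {Ω : Set (Euc d)} (hΩ : IsCompact Ω) (μ : VMeas Ω V) {φ φ' : Euc d → V}
    (hφ : ContinuousOn φ Ω) (hφ' : ContinuousOn φ' Ω) (ε : ℝ)
    (h : ∀ x ∈ Ω, ‖φ x - φ' x‖ ≤ ε) :
    |μ.pair φ - μ.pair φ'| ≤ ε * μ.tv := by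
  unfold VMeas.pair VMeas.tv
  rw [← integral_sub (μ.pair_integrable hΩ hφ) (μ.pair_integrable hΩ hφ'), ← integral_const_mul,
    ← Real.norm_eq_abs]
  refine norm_integral_le_of_norm_le (μ.integrable.norm.const_mul ε) ?_
  filter_upwards [μ.ae_mem] with x hx
  rw [← inner_sub_left]
  exact (norm_inner_le_norm _ _).trans (mul_le_mul_of_nonneg_right (h x hx) (norm_nonneg _))

theorem fpair_le_ftv {Ω : Set (Euc d)} (σ : VMeas Ω (Euc d →L[ℝ] V)) (ψ : Euc d → Euc d →L[ℝ] V)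
    (h : ∀ x ∈ Ω, frobNorm (ψ x) ≤ 1) : σ.fpair ψ ≤ σ.ftv := by
  unfold VMeas.fpair VMeas.ftv
  refine (le_abs_self _).trans ?_
  rw [← Real.norm_eq_abs]
  refine norm_integral_le_of_norm_le ?_ ?_
  · simp only [frobNorm_eq]
    exact (toW.integrable_comp σ.integrable).norm
  · filter_upwards [σ.ae_mem] with x hx
    refine (abs_frobInner_le _ _).trans ?_
    refine mul_le_of_le_one_left ?_ (h x hx)
    rw [frobNorm_eq]; exact norm_nonneg _

/-- C¹ functions have their gradient as a distributional gradient. -/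
theorem isDistribGrad_of_contDiff {Ω : Set (Euc d)} {φ : Euc d → V} (hφ : ContDiff ℝ 1 φ) :
    IsDistribGrad Ω φ (fderiv ℝ φ) := by
  rintro ψ ⟨hψ, hcs, hsupp⟩
  have hψ1 : ContDiff ℝ 1 ψ := hψ.of_le (by exact_mod_cast le_top)
  have hψd : Differentiable ℝ ψ := hψ1.differentiable (by norm_num)
  have hψ' : Continuous (fderiv ℝ ψ) := hψ1.continuous_fderiv (by norm_num)
  have hφ' : Continuous (fderiv ℝ φ) := hφ.continuous_fderiv (by norm_num)
  have hcs' : HasCompactSupport (fderiv ℝ ψ) := hcs.fderiv (𝕜 := ℝ)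
  have hout : ∀ x, x ∉ Ω → x ∉ tsupport ψ := fun x hx h => hx (interior_subset (hsupp h))
  have e1 : ∫ x in Ω, ⟪φ x, divg ψ x⟫ = ∫ x, ⟪φ x, divg ψ x⟫ := by
    refine setIntegral_eq_integral_of_forall_compl_eq_zero fun x hx => ?_
    have : fderiv ℝ ψ x = 0 := by
      by_contra h0
      exact hout x hx (support_fderiv_subset ℝ h0)
    simp [divg, this]
  have e2 : ∫ x in Ω, frobInner (fderiv ℝ φ x) (ψ x) = ∫ x, frobInner (fderiv ℝ φ x) (ψ x) := by
    refine setIntegral_eq_integral_of_forall_compl_eq_zero fun x hx => ?_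
    simp [frobInner, image_eq_zero_of_notMem_tsupport (hout x hx)]
  rw [e1, e2]
  simp only [divg, frobInner, inner_sum]
  have i1 : ∀ i : Fin d, Integrable (fun x => ⟪φ x, fderiv ℝ ψ x (EuclideanSpace.single i 1)
      (EuclideanSpace.single i 1)⟫) := by
    intro i
    refine Continuous.integrable_of_hasCompactSupport ?_ ?_
    · exact hφ.continuous.inner (by fun_prop)
    · exact hcs'.mono' (fun x hx => subset_tsupport _ (by
        intro h0; apply hx; simp [h0]))
  have i2 : ∀ i : Fin d, Integrable (fun x => ⟪fderiv ℝ φ x (EuclideanSpace.single i 1), 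
      ψ x (EuclideanSpace.single i 1)⟫) := by
    intro i
    refine Continuous.integrable_of_hasCompactSupport ?_ ?_
    · have := hψ.continuous
      exact Continuous.inner (by fun_prop) (by fun_prop)
    · exact hcs.mono' (fun x hx => subset_tsupport _ (by
        intro h0; apply hx; simp [h0]))
  have i3 : ∀ i : Fin d, Integrable (fun x => ⟪φ x, ψ x (EuclideanSpace.single i 1)⟫) := by
    intro i
    refine Continuous.integrable_of_hasCompactSupport ?_ ?_
    · have := hψ.continuous
      exact hφ.continuous.inner (by fun_prop)
    · exact hcs.mono' (fun x hx => subset_tsupport _ (by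
        intro h0; apply hx; simp [h0]))
  rw [integral_finsetSum _ (fun i _ => i1 i), integral_finsetSum _ (fun i _ => i2 i),
    ← Finset.sum_neg_distrib]
  refine Finset.sum_congr rfl fun i _ => ?_
  have hfd : ∀ x, fderiv ℝ (fun y => ψ y (EuclideanSpace.single i 1)) x
      (EuclideanSpace.single i 1) =
      fderiv ℝ ψ x (EuclideanSpace.single i 1) (EuclideanSpace.single i 1) := by
    intro x
    rw [fderiv_clm_apply (hψd x) (differentiableAt_const _)]
    simp
  have key := integral_bilinear_fderiv_right_eq_neg_left_of_integrable (μ := (volume : Measure (Euc d)))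
    (f := φ) (g := fun y => ψ y (EuclideanSpace.single i 1)) (v := EuclideanSpace.single i 1)
    (B := (innerSL ℝ : V →L[ℝ] V →L[ℝ] ℝ)) (i2 i) (by simp only [hfd]; exact i1 i) (i3 i)
    (fun x _ => hφ.differentiable (by norm_num) x)
    (fun x _ => (hψd x).clm_apply (differentiableAt_const _))
  simp only [hfd] at key
  exact key

theorem frLipOn_of_contDiff {Ω : Set (Euc d)} {φ : Euc d → V} (hΩ : IsCompact Ω)
    (hφ : ContDiff ℝ 1 φ)
    (h : ∀ x ∈ Ω, frobNorm (fderiv ℝ φ x) ≤ 1) : FrLipOn 1 Ω φ := by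
  refine ⟨hφ.continuous.continuousOn, fderiv ℝ φ, ?_, ?_, isDistribGrad_of_contDiff hφ⟩
  · exact (hφ.continuous_fderiv (by norm_num)).aestronglyMeasurable
  · exact (ae_restrict_iff' hΩ.measurableSet).2 (ae_of_all _ h)

theorem push_meas {Ω : Set (Euc d)} (hΩ : IsCompact Ω) (ρ : Measure Ω) (k : Ω → WW d V)
    (hk : Integrable k ρ) : ∃ σ : VMeas Ω (Euc d →L[ℝ] V),
      (∀ ψ, σ.fpair ψ = ∫ x : Ω, ⟪toW (ψ x), k x⟫ ∂ρ) ∧ σ.ftv = ∫ x, ‖k x‖ ∂ρ := by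
  have hemb : MeasurableEmbedding (Subtype.val : Ω → Euc d) :=
    MeasurableEmbedding.subtype_coe hΩ.measurableSet
  let den : Euc d → (Euc d →L[ℝ] V) := Function.extend Subtype.val (fun x => fromW (k x)) 0
  have hden : ∀ x : Ω, den x = fromW (k x) := fun x => Subtype.val_injective.extend_apply _ _ x
  have hnull : ρ.map Subtype.val Ωᶜ = 0 := by
    rw [hemb.map_apply]
    have : (Subtype.val ⁻¹' Ωᶜ : Set Ω) = ∅ := by ext x; simp
    rw [this, measure_empty]
  have hint : Integrable den (ρ.map Subtype.val) := by
    rw [hemb.integrable_map_iff]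
    have h1 : den ∘ Subtype.val = fun x : Ω => fromW (k x) := funext hden
    rw [h1]
    exact ContinuousLinearMap.integrable_comp (fromW (d := d) (V := V)) hk
  refine ⟨⟨ρ.map Subtype.val, den, hnull, hint⟩, ?_, ?_⟩
  · intro ψ
    unfold VMeas.fpair
    dsimp only
    rw [hemb.integral_map]
    simp only [hden, frobInner_eq, toW_fromW]
  · unfold VMeas.ftv
    dsimp only
    rw [hemb.integral_map]
    simp only [hden, frobNorm_eq, toW_fromW]

def C1sub (d : ℕ) (V : Type*) [NormedAddCommGroup V] [InnerProductSpace ℝ V] :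
    Submodule ℝ (Euc d → V) where
  carrier := {φ | ContDiff ℝ 1 φ}
  add_mem' := by
    intro a b ha hb
    rw [mem_ofPred_eq] at *
    exact ha.add hb
  zero_mem' := by
    rw [mem_ofPred_eq]
    exact contDiff_const
  smul_mem' := by
    intro c a ha
    rw [mem_ofPred_eq] at *
    exact ha.const_smul c

theorem beckmann_le_dual (Ω : Set (Euc d)) (hΩ : IsCompact Ω) (hne : Ω.Nonempty)
    (μ ν : VMeas Ω V) (hfin : W1fn Ω (fun φ => ν.pair φ - μ.pair φ) ≠ ⊤) :
    ∃ σ : VMeas Ω (Euc d →L[ℝ] V), DivEq σ (fun φ => μ.pair φ - ν.pair φ) ∧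
      σ.ftv ≤ (W1fn Ω (fun φ => ν.pair φ - μ.pair φ)).toReal := by
  set S := (W1fn Ω (fun φ => ν.pair φ - μ.pair φ)).toReal with hSdef
  have hS : 0 ≤ S := ENNReal.toReal_nonneg
  have hdual : ∀ φ, FrLipOn 1 Ω φ → ν.pair φ - μ.pair φ ≤ S := by
    intro φ hφ
    have h1 : ENNReal.ofReal (ν.pair φ - μ.pair φ) ≤ W1fn Ω (fun φ => ν.pair φ - μ.pair φ) :=
      le_iSup₂_of_le (f := fun φ (_ : φ ∈ {φ : Euc d → V | FrLipOn 1 Ω φ}) =>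
        ENNReal.ofReal (ν.pair φ - μ.pair φ)) φ hφ le_rfl
    exact (ENNReal.ofReal_le_iff_le_toReal hfin).1 h1
  let E : Submodule ℝ (Euc d → V) := C1sub d V
  have hE : ∀ e : E, ContDiff ℝ 1 (e : Euc d → V) := fun e => e.2
  have hEd : ∀ (e : E) x, DifferentiableAt ℝ (e : Euc d → V) x := fun e x =>
    (hE e).differentiable (by norm_num) x
  let L : E →ₗ[ℝ] ℝ :=
    { toFun := fun e => ν.pair e - μ.pair e
      map_add' := by
        intro a b
        have ha := (hE a).continuous.continuousOn (s := Ω)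
        have hb := (hE b).continuous.continuousOn (s := Ω)
        rw [Submodule.coe_add, ν.pair_add hΩ ha hb, μ.pair_add hΩ ha hb]
        ring
      map_smul' := by
        intro c a
        rw [Submodule.coe_smul, ν.pair_smul, μ.pair_smul, RingHom.id_apply, smul_eq_mul]
        ring }
  let T : E →ₗ[ℝ] C(Ω, WW d V) :=
    { toFun := fun e => ⟨fun x => toW (fderiv ℝ e x), by
        have := (hE e).continuous_fderiv (by norm_num)
        fun_prop⟩
      map_add' := by
        intro a b
        ext1 x
        simp only [ContinuousMap.coe_mk, ContinuousMap.add_apply, Submodule.coe_add]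
        rw [fderiv_add (hEd a x) (hEd b x), map_add]
      map_smul' := by
        intro c a
        ext1 x
        simp only [ContinuousMap.coe_mk, ContinuousMap.smul_apply, Submodule.coe_smul,
          RingHom.id_apply]
        rw [fderiv_const_smul (hEd a x), map_smul] }
  have hT : ∀ (e : E) (x : Ω), T e x = toW (fderiv ℝ e x) := fun _ _ => rfl
  have : CompactSpace Ω := isCompact_iff_compactSpace.mp hΩ
  have : Nonempty Ω := hne.to_subtype
  have hbound : ∀ e, L e ≤ S * ⨆ x, ‖T e x‖ := by
    intro e
    set M := ⨆ x, ‖T e x‖ with hM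
    have hM0 : 0 ≤ M := Real.iSup_nonneg fun x => norm_nonneg _
    have hle : ∀ x : Ω, ‖T e x‖ ≤ M :=
      fun x => le_ciSup (f := fun x => ‖T e x‖) (isCompact_range (by fun_prop)).bddAbove x
    have hε : ∀ ε > 0, L e ≤ S * (M + ε) := by
      intro ε hε
      have hpos : 0 < M + ε := by linarith
      have h1 : FrLipOn 1 Ω ((M + ε)⁻¹ • (e : Euc d → V)) := by
        refine frLipOn_of_contDiff hΩ ((hE e).const_smul _) fun x hx => ?_
        rw [fderiv_const_smul (hEd e x), frobNorm_smul, abs_of_pos (inv_pos.2 hpos), frobNorm_eq]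
        have := hle ⟨x, hx⟩
        rw [hT] at this
        rw [inv_mul_le_iff₀ hpos]
        linarith
      have h2 := hdual _ h1
      rw [ν.pair_smul, μ.pair_smul, ← mul_sub, inv_mul_le_iff₀ hpos] at h2
      rw [mul_comm]
      exact h2
    have hlim : Tendsto (fun ε : ℝ => S * (M + ε)) (𝓝[>] 0) (𝓝 (S * (M + 0))) :=
      (Continuous.tendsto (by fun_prop) 0).mono_left nhdsWithin_le_nhds
    rw [add_zero] at hlim
    exact ge_of_tendsto hlim (by filter_upwards [self_mem_nhdsWithin] with ε h using hε ε h)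
  obtain ⟨ρ, k, hk, hkL, hkS⟩ := vecRiesz T L S hS hbound
  obtain ⟨σ, hσ1, hσ2⟩ := push_meas hΩ ρ k hk
  refine ⟨σ, ?_, ?_⟩
  · intro φ hφ
    have h1 := hkL ⟨φ, hφ⟩
    have h2 : σ.fpair (fun x => fderiv ℝ φ x) = L ⟨φ, hφ⟩ := by
      rw [← h1, hσ1]
      rfl
    rw [h2]
    simp [L]
  · rw [hσ2]
    exact hkS


open scoped Convolution in
theorem grad_moll {Ω : Set (Euc d)} (hΩ : IsCompact Ω) {φ : Euc d → V} (hφ : FrLipOn 1 Ω φ)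
    (η : ContDiffBump (0 : Euc d)) (z : Euc d) (hz : Metric.closedBall z η.rOut ⊆ interior Ω) :
    frobNorm (fderiv ℝ (η.normed volume ⋆[ContinuousLinearMap.lsmul ℝ ℝ, volume]
      (Ω.indicator φ)) z) ≤ 1 := by
  obtain ⟨hcont, g, hgm, hgb, hgrad⟩ := hφ
  have hmΩ := hΩ.measurableSet
  have hloc : LocallyIntegrable (Ω.indicator φ) volume :=
    ((hcont.integrableOn_compact hΩ).integrable_indicator hmΩ).locallyIntegrable
  set e : Euc d → ℝ := η.normed volume with he
  have hecd : ContDiff ℝ (⊤ : ℕ∞) e := η.contDiff_normed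
  have hecd1 : ContDiff ℝ 1 e := η.contDiff_normed
  have hed : Differentiable ℝ e := hecd1.differentiable (by norm_num)
  have hecs : HasCompactSupport e := η.hasCompactSupport_normed
  have hec' : Continuous (fderiv ℝ e) := hecd1.continuous_fderiv (by norm_num)
  have hecs' : HasCompactSupport (fderiv ℝ e) := hecs.fderiv (𝕜 := ℝ)
  let L : ℝ →L[ℝ] V →L[ℝ] V := ContinuousLinearMap.lsmul ℝ ℝ
  have hder := (hecs.hasFDerivAt_convolution_left L hecd1 hloc z).fderiv
  set A : Euc d →L[ℝ] V := fderiv ℝ (e ⋆[L, volume] (Ω.indicator φ)) z with hA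
  change frobNorm A ≤ 1
  let K : Euc d → (Euc d →L[ℝ] V) := fun t => L.precompL (Euc d) (fderiv ℝ e (z - t))
    (Ω.indicator φ t)
  have hKint : Integrable K volume :=
    (hecs'.convolutionExists_left (L.precompL (Euc d)) hec' hloc z).integrable_swap
  have hAK : A = ∫ t, K t := by
    rw [hder, convolution_eq_swap]
  let ψ : Euc d → (Euc d →L[ℝ] V) := fun t => e (z - t) • A
  have hψfd : ∀ t v, fderiv ℝ ψ t v = -(fderiv ℝ e (z - t) v) • A := by
    intro t v
    have h1 : HasFDerivAt (fun t => z - t) (-(ContinuousLinearMap.id ℝ (Euc d))) t :=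
      (hasFDerivAt_id t).const_sub z
    have h2 := ((hed (z - t)).hasFDerivAt.comp t h1).smul_const A
    have h3 : fderiv ℝ ψ t = _ := h2.fderiv
    rw [h3]
    simp
  have hψtest : IsTest Ω ψ := by
    have hsub : tsupport ψ ⊆ Metric.closedBall z η.rOut := by
      refine closure_minimal ?_ Metric.isClosed_closedBall
      intro t ht
      have h1 : e (z - t) ≠ 0 := by
        intro h0
        apply ht
        simp [ψ, h0]
      have h2 : z - t ∈ Function.support e := h1
      rw [he, η.support_normed_eq] at h2
      rw [Metric.mem_closedBall, dist_comm, dist_eq_norm]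
      have := Metric.mem_ball.1 h2
      rw [dist_zero_right] at this
      exact this.le
    refine ⟨?_, ?_, hsub.trans hz⟩
    · exact (hecd.comp (contDiff_const.sub contDiff_id)).smul contDiff_const
    · exact HasCompactSupport.of_support_subset_isCompact (isCompact_closedBall z η.rOut)
        ((subset_tsupport _).trans hsub)
  have h1 : frobInner A A = ∫ t, frobInner (K t) A := by
    have := ((innerSL ℝ (toW A)).comp toW).integral_comp_comm hKint
    rw [← hAK] at this
    simp only [ContinuousLinearMap.comp_apply, innerSL_apply_apply] at this
    simp only [frobInner_eq]
    rw [← this]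
    exact integral_congr_ae (ae_of_all _ fun t => real_inner_comm _ _)
  have h2 : ∀ t, frobInner (K t) A = Ω.indicator (fun t => -⟪φ t, divg ψ t⟫) t := by
    intro t
    by_cases ht : t ∈ Ω
    · rw [indicator_of_mem ht]
      simp only [frobInner, divg, K, hψfd, indicator_of_mem ht, inner_sum]
      rw [← Finset.sum_neg_distrib]
      refine Finset.sum_congr rfl fun i _ => ?_
      rw [ContinuousLinearMap.precompL_apply]
      simp [L, inner_smul_left, inner_smul_right]
    · rw [indicator_of_notMem ht]
      simp [K, indicator_of_notMem ht, frobInner]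
  have h3 : frobInner A A = ∫ x in Ω, frobInner (g x) (ψ x) := by
    rw [h1]
    simp only [h2]
    rw [integral_indicator hmΩ, integral_neg, hgrad ψ hψtest, neg_neg]
  have heint : Integrable (fun x => e (z - x)) volume :=
    (hecd.continuous.integrable_of_hasCompactSupport hecs).comp_sub_left z
  have hA0 : 0 ≤ frobNorm A := Real.sqrt_nonneg _
  have h4 : frobInner A A ≤ frobNorm A := by
    rw [h3]
    calc ∫ x in Ω, frobInner (g x) (ψ x) ≤ ‖∫ x in Ω, frobInner (g x) (ψ x)‖ := le_abs_self _
      _ ≤ ∫ x in Ω, e (z - x) * frobNorm A := by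
        refine norm_integral_le_of_norm_le (heint.mul_const _).integrableOn ?_
        filter_upwards [hgb] with x hx
        refine (abs_frobInner_le _ _).trans ?_
        rw [frobNorm_smul, abs_of_nonneg (η.nonneg_normed _)]
        exact mul_le_of_le_one_left (mul_nonneg (η.nonneg_normed _) hA0) hx
      _ ≤ ∫ x, e (z - x) * frobNorm A := by
        refine setIntegral_le_integral (heint.mul_const _) (ae_of_all _ fun x => ?_)
        exact mul_nonneg (η.nonneg_normed _) hA0
      _ = frobNorm A := by
        rw [integral_mul_const, integral_sub_left_eq_self e volume z, he, η.integral_normed, one_mul]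
  rw [frobInner_self] at h4
  by_contra hcon
  push Not at hcon
  nlinarith

open scoped Convolution in
theorem smooth_approx {Ω : Set (Euc d)} (hΩ : IsCompact Ω) (hconv : Convex ℝ Ω)
    (hint : (interior Ω).Nonempty) {φ : Euc d → V} (hφ : FrLipOn 1 Ω φ) (ε : ℝ) (hε : 0 < ε) :
    ∃ φ' : Euc d → V, ContDiff ℝ 1 φ' ∧ (∀ x ∈ Ω, ‖φ x - φ' x‖ ≤ ε) ∧
      ∀ x ∈ Ω, frobNorm (fderiv ℝ φ' x) ≤ 1 := by
  obtain ⟨x0, hx0⟩ := hint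
  have hcont := hφ.1
  obtain ⟨R, hR0, hR⟩ : ∃ R : ℝ, 0 < R ∧ ∀ x ∈ Ω, ‖x0 - x‖ ≤ R := by
    obtain ⟨C, hC⟩ := hΩ.exists_bound_of_continuousOn
      (f := fun x => x0 - x) (by fun_prop)
    exact ⟨max C 1, by positivity, fun x hx => (hC x hx).trans (le_max_left _ _)⟩
  obtain ⟨δ, hδ, hunif⟩ := Metric.uniformContinuousOn_iff.1
    (hΩ.uniformContinuousOn_of_continuous hcont) (ε / 2) (by positivity)
  let t : ℝ := min (1 / 2) (δ / (2 * R))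
  have ht0 : 0 < t := by positivity
  have ht1 : t ≤ 1 / 2 := min_le_left _ _
  have htR : t * R < δ := by
    have : t ≤ δ / (2 * R) := min_le_right _ _
    calc t * R ≤ δ / (2 * R) * R := by gcongr
      _ = δ / 2 := by field_simp
      _ < δ := by linarith
  let p : Euc d → Euc d := fun x => (1 - t) • x + t • x0
  have hpc : Continuous p := by fun_prop
  have hpint : ∀ x ∈ Ω, p x ∈ interior Ω := fun x hx =>
    hconv.combo_self_interior_mem_interior hx hx0 (by linarith) ht0 (by ring)
  have hpd : ∀ x ∈ Ω, dist (p x) x < δ := by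
    intro x hx
    have : p x - x = t • (x0 - x) := by
      simp only [p]; module
    rw [dist_eq_norm, this, norm_smul, Real.norm_eq_abs, abs_of_pos ht0]
    exact (mul_le_mul_of_nonneg_left (hR x hx) ht0.le).trans_lt htR
  obtain ⟨r0, hr0, hr0s⟩ := (hΩ.image hpc).exists_cthickening_subset_open isOpen_interior
    (by rintro _ ⟨x, hx, rfl⟩; exact hpint x hx)
  let r : ℝ := min r0 δ
  have hr : 0 < r := lt_min hr0 hδ
  let η : ContDiffBump (0 : Euc d) := ⟨r / 2, r, by positivity, by linarith⟩
  have hball : ∀ x ∈ Ω, Metric.closedBall (p x) η.rOut ⊆ interior Ω := by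
    intro x hx
    refine (Metric.closedBall_subset_closedBall (min_le_left _ _)).trans (Subset.trans ?_ hr0s)
    exact Metric.closedBall_subset_cthickening (mem_image_of_mem p hx) r0
  have hmΩ := hΩ.measurableSet
  have hI := (hcont.integrableOn_compact (μ := volume) hΩ).integrable_indicator hmΩ
  let h : Euc d → V := η.normed volume ⋆[ContinuousLinearMap.lsmul ℝ ℝ, volume] (Ω.indicator φ)
  have hh : ContDiff ℝ 1 h :=
    η.hasCompactSupport_normed.contDiff_convolution_left (n := 1) _ η.contDiff_normed
      hI.locallyIntegrable
  refine ⟨fun x => h (p x), hh.comp (by fun_prop), ?_, ?_⟩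
  · intro x hx
    have hpx : p x ∈ Ω := interior_subset (hpint x hx)
    have h1 : dist (h (p x)) (Ω.indicator φ (p x)) ≤ ε / 2 := by
      refine η.dist_normed_convolution_le hI.1 ?_
      intro y hy
      have hyΩ : y ∈ Ω := interior_subset (hball x hx (Metric.ball_subset_closedBall hy))
      rw [indicator_of_mem hyΩ, indicator_of_mem hpx]
      exact (hunif y hyΩ _ hpx ((Metric.mem_ball.1 hy).trans_le (min_le_right _ _))).le
    rw [indicator_of_mem hpx] at h1
    have h2 := hunif _ hpx x hx (hpd x hx)
    rw [← dist_eq_norm, dist_comm]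
    have := dist_triangle (h (p x)) (φ (p x)) (φ x)
    linarith
  · intro x hx
    have h1 : HasFDerivAt p ((1 - t) • ContinuousLinearMap.id ℝ (Euc d)) x :=
      ((hasFDerivAt_id x).const_smul (1 - t)).add_const _
    have h2 := ((hh.differentiable (by norm_num) (p x)).hasFDerivAt.comp x h1).fderiv
    have h3 : fderiv ℝ (fun x => h (p x)) x = (1 - t) • fderiv ℝ h (p x) := by
      refine Eq.trans h2 ?_
      ext v
      simp
    rw [h3, frobNorm_smul, abs_of_nonneg (by linarith)]
    have h4 := grad_moll hΩ hφ η (p x) (hball x hx)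
    have h5 : 0 ≤ frobNorm (fderiv ℝ h (p x)) := Real.sqrt_nonneg _
    change frobNorm (fderiv ℝ h (p x)) ≤ 1 at h4
    nlinarith

theorem dual_le_beckmann {Ω : Set (Euc d)} (hΩ : IsCompact Ω) (hconv : Convex ℝ Ω)
    (hint : (interior Ω).Nonempty) (μ ν : VMeas Ω V) {φ : Euc d → V} (hφ : FrLipOn 1 Ω φ)
    (σ : VMeas Ω (Euc d →L[ℝ] V)) (hσ : DivEq σ (fun φ => μ.pair φ - ν.pair φ)) :
    ν.pair φ - μ.pair φ ≤ σ.ftv := by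
  have key : ∀ ε > 0, ν.pair φ - μ.pair φ ≤ σ.ftv + ε * (μ.tv + ν.tv) := by
    intro ε hε
    obtain ⟨φ', hc, hclose, hgr⟩ := smooth_approx hΩ hconv hint hφ ε hε
    have h1 := hσ φ' hc
    have h2 := fpair_le_ftv σ (fun x => fderiv ℝ φ' x) hgr
    have h3 := abs_le.1 (μ.pair_sub_le hΩ hφ.1 hc.continuous.continuousOn ε hclose)
    have h4 := abs_le.1 (ν.pair_sub_le hΩ hφ.1 hc.continuous.continuousOn ε hclose)
    dsimp only at h1
    linarith [h3.1, h3.2, h4.1, h4.2]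
  have hlim : Tendsto (fun ε : ℝ => σ.ftv + ε * (μ.tv + ν.tv)) (𝓝[>] 0)
      (𝓝 (σ.ftv + 0 * (μ.tv + ν.tv))) :=
    (Continuous.tendsto (by fun_prop) 0).mono_left nhdsWithin_le_nhds
  rw [zero_mul, add_zero] at hlim
  exact ge_of_tendsto hlim (by filter_upwards [self_mem_nhdsWithin] with ε h using key ε h)

/-- for `μ, ν ∈ M(Ω;V)` with the same total mass, the dual value
`sup { ∫_Ω ⟨φ, ν-μ⟩_V : |∇φ|_{V^d,∞} ≤ 1 }` equals the Beckmann value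
`inf { ∫_Ω |σ|_{V^d} : σ ∈ M(Ω;V^d), div σ = μ - ν }`. -/
theorem dual_eq_beckmann
    (Ω : Set (Euc d)) (hΩcomp : IsCompact Ω) (hΩconv : Convex ℝ Ω)
    (hΩint : (interior Ω).Nonempty)
    (μ ν : VMeas Ω V) (hmass : μ.mass = ν.mass) :
    W1fn Ω (fun φ => ν.pair φ - μ.pair φ) =
      ⨅ σ ∈ {σ : VMeas Ω (Euc d →L[ℝ] V) |
          DivEq σ (fun φ => μ.pair φ - ν.pair φ)},
        ENNReal.ofReal σ.ftv := by
  apply le_antisymm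
  · refine le_iInf₂ fun σ hσ => iSup₂_le fun φ hφ => ?_
    exact ENNReal.ofReal_le_ofReal (dual_le_beckmann hΩcomp hΩconv hΩint μ ν hφ σ hσ)
  · by_cases hfin : W1fn Ω (fun φ => ν.pair φ - μ.pair φ) = ⊤
    · rw [hfin]; exact le_top
    · obtain ⟨σ, hσ, hle⟩ := beckmann_le_dual Ω hΩcomp (hΩint.mono interior_subset) μ ν hfin
      refine iInf₂_le_of_le σ hσ ?_
      exact ENNReal.ofReal_le_of_le_toReal hle
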